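/- Williamson normal form: let s ≥ 1, let Δ be the standard 2s×2s symplectic matrix given by the block-diagonal matrix with s diagonal blocks [[0, −1], [1, 0]], and let α be a real symmetric positive definite 2s×2s matrix. Then there exists a real 2s×2s matrix T with TᵀΔT = Δ (i.e. T is Δ-symplectic) and positive reals d_1, …, d_s such that TᵀαT is the block-diagonal matrix with diagonal blocks d_j·I₂ for j = 1, …, s. -/

import Mathlib

open Matrix

/-- The standard `2s × 2s` symplectic matrix: block diagonal with `s` blocks
`[[0, -1], [1, 0]]`, indexed by `Fin 2 × Fin s`. -/
def stdSymplectic (s : ℕ) : Matrix (Fin 2 × Fin s) (Fin 2 × Fin s) ℝ :=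
  Matrix.blockDiagonal fun _ : Fin s => !![0, -1; 1, 0]

/-- Orthonormal normal form for injective skew-adjoint operators on a real Euclidean space. -/
theorem skew_normal_form (s : ℕ) : ∀ (E : Type) [NormedAddCommGroup E] [InnerProductSpace ℝ E]
    [FiniteDimensional ℝ E] (A : E →ₗ[ℝ] E), Module.finrank ℝ E = 2 * s →
    (∀ u v, inner ℝ (A u) v = - inner ℝ u (A v)) → Function.Injective A →
    ∃ (x y : Fin s → E) (c : Fin s → ℝ), (∀ j, 0 < c j) ∧
      (∀ i j, inner ℝ (x i) (x j) = if i = j then (1 : ℝ) else 0) ∧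
      (∀ i j, inner ℝ (y i) (y j) = if i = j then (1 : ℝ) else 0) ∧
      (∀ i j, inner ℝ (x i) (y j) = (0 : ℝ)) ∧
      (∀ j, A (x j) = c j • y j) ∧ (∀ j, A (y j) = -(c j • x j)) := by
  induction s with
  | zero =>
    intro E _ _ _ A _ _ _
    exact ⟨Fin.elim0, Fin.elim0, Fin.elim0, fun j => j.elim0, fun j => j.elim0,
      fun j => j.elim0, fun j => j.elim0, fun j => j.elim0, fun j => j.elim0⟩
  | succ s ih =>
    intro E _ _ _ A hdim hskew hinj
    have hsym : (A * A).IsSymmetric := by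
      intro u v
      simp [Module.End.mul_apply, hskew]
    let i0 : Fin (2 * (s + 1)) := ⟨0, by omega⟩
    obtain ⟨x, μ, hx1, hAx⟩ : ∃ (x : E) (μ : ℝ), ‖x‖ = 1 ∧ A (A x) = μ • x :=
      ⟨hsym.eigenvectorBasis hdim i0, hsym.eigenvalues hdim i0,
        (hsym.eigenvectorBasis hdim).orthonormal.1 i0, by
          exact hsym.apply_eigenvectorBasis hdim i0⟩
    have hxx : inner ℝ x x = (1 : ℝ) := by rw [real_inner_self_eq_norm_sq, hx1]; norm_num
    have hx0 : x ≠ 0 := by rintro rfl; simp at hx1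
    have hAx0 : A x ≠ 0 := fun h => hx0 (hinj (by rw [h, map_zero]))
    set c : ℝ := ‖A x‖ with hc
    have hcpos : 0 < c := norm_pos_iff.mpr hAx0
    have hμ : μ = -(c * c) := by
      have h1 : inner ℝ (A x) (A x) = c * c := real_inner_self_eq_norm_mul_norm _
      rw [hskew, hAx, inner_smul_right, hxx] at h1
      linarith
    have hxAx : inner ℝ x (A x) = (0 : ℝ) := by
      have h1 := hskew x x
      rw [real_inner_comm] at h1
      linarith
    set y : E := c⁻¹ • A x with hy
    have hAxy : A x = c • y := by rw [hy, smul_smul, mul_inv_cancel₀ hcpos.ne', one_smul]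
    have hAy : A y = -(c • x) := by
      rw [hy, map_smul, hAx, smul_smul, hμ, ← neg_smul]
      congr 1
      field_simp
    have hxy : inner ℝ x y = (0 : ℝ) := by rw [hy, inner_smul_right, hxAx, mul_zero]
    have hyx : inner ℝ y x = (0 : ℝ) := by rw [real_inner_comm, hxy]
    have hy1 : ‖y‖ = 1 := by
      rw [hy, norm_smul, norm_inv, Real.norm_of_nonneg hcpos.le, ← hc, inv_mul_cancel₀ hcpos.ne']
    have hyy : inner ℝ y y = (1 : ℝ) := by rw [real_inner_self_eq_norm_sq, hy1]; norm_num
    have hon : Orthonormal ℝ ![x, y] := by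
      rw [orthonormal_iff_ite]
      intro i j
      fin_cases i <;> fin_cases j <;> simp [hxx, hxy, hyx, hyy, hx1, hy1]
    let U : Submodule ℝ E := Submodule.span ℝ (Set.range ![x, y])
    have hU : Module.finrank ℝ U = 2 := by
      simpa using finrank_span_eq_card hon.linearIndependent
    have hW : Module.finrank ℝ Uᗮ = 2 * s := by
      have := U.finrank_add_finrank_orthogonal
      omega
    have memW : ∀ w : E, w ∈ Uᗮ ↔ inner ℝ x w = (0 : ℝ) ∧ inner ℝ y w = (0 : ℝ) := by
      intro w
      constructor
      · intro hw
        rw [Submodule.mem_orthogonal] at hw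
        exact ⟨hw x (Submodule.subset_span ⟨0, rfl⟩), hw y (Submodule.subset_span ⟨1, rfl⟩)⟩
      · rintro ⟨h1, h2⟩
        rw [Submodule.mem_orthogonal]
        intro u hu
        induction hu using Submodule.span_induction with
        | mem u hu =>
          obtain ⟨i, rfl⟩ := hu
          fin_cases i
          · exact h1
          · exact h2
        | zero => simp
        | add u v _ _ hu hv => rw [inner_add_left, hu, hv, add_zero]
        | smul a u _ hu => rw [real_inner_smul_left, hu, mul_zero]
    have hinv : ∀ w ∈ Uᗮ, A w ∈ Uᗮ := by
      intro w hw
      rw [memW] at hw ⊢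
      have h1 := hskew x w
      have h2 := hskew y w
      rw [hAxy, real_inner_smul_left, hw.2] at h1
      rw [hAy, inner_neg_left, real_inner_smul_left, hw.1] at h2
      constructor <;> linarith
    obtain ⟨x', y', c', hc', hx', hy', hxy', hA1, hA2⟩ := ih Uᗮ (A.restrict hinv) hW
      (fun u v => by simpa using hskew u v)
      (fun u v huv => Subtype.ext (hinj (by simpa using congrArg Subtype.val huv)))
    have hx'W := fun j => (memW _).1 (x' j).2
    have hy'W := fun j => (memW _).1 (y' j).2
    refine ⟨Fin.cons x (fun j => (x' j : E)), Fin.cons y (fun j => (y' j : E)), Fin.cons c c',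
      ?_, ?_, ?_, ?_, ?_, ?_⟩
    · intro j
      refine Fin.cases ?_ (fun j => ?_) j
      · simpa using hcpos
      · simpa using hc' j
    · intro i j
      refine Fin.cases ?_ (fun i => ?_) i <;> refine Fin.cases ?_ (fun j => ?_) j
      · simp [hx1]
      · simpa [(Fin.succ_ne_zero j).symm] using (hx'W j).1
      · simpa [real_inner_comm] using (hx'W i).1
      · simpa using hx' i j
    · intro i j
      refine Fin.cases ?_ (fun i => ?_) i <;> refine Fin.cases ?_ (fun j => ?_) j
      · simp [hy1]
      · simpa [(Fin.succ_ne_zero j).symm] using (hy'W j).2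
      · simpa [real_inner_comm] using (hy'W i).2
      · simpa using hy' i j
    · intro i j
      refine Fin.cases ?_ (fun i => ?_) i <;> refine Fin.cases ?_ (fun j => ?_) j
      · simpa using hxy
      · simpa using (hy'W j).1
      · simpa [real_inner_comm] using (hx'W i).2
      · simpa using hxy' i j
    · intro j
      refine Fin.cases ?_ (fun j => ?_) j
      · simpa using hAxy
      · simpa using congrArg Subtype.val (hA1 j)
    · intro j
      refine Fin.cases ?_ (fun j => ?_) j
      · simpa using hAy
      · simpa using congrArg Subtype.val (hA2 j)

/-- Matrix version: orthogonal normal form of an invertible skew-symmetric matrix. -/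
theorem skew_matrix_normal_form (s : ℕ) (M : Matrix (Fin 2 × Fin s) (Fin 2 × Fin s) ℝ)
    (hM : Mᵀ = -M) (hu : IsUnit M) :
    ∃ (Q : Matrix (Fin 2 × Fin s) (Fin 2 × Fin s) ℝ) (c : Fin s → ℝ), (∀ j, 0 < c j) ∧
      Qᵀ * Q = 1 ∧ Qᵀ * M * Q = Matrix.blockDiagonal fun j => c j • !![0, -1; 1, 0] := by
  have key : ∀ u v : EuclideanSpace ℝ (Fin 2 × Fin s), inner ℝ u v = u.ofLp ⬝ᵥ v.ofLp := by
    intro u v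
    rw [EuclideanSpace.inner_eq_star_dotProduct]
    simp [dotProduct_comm]
  obtain ⟨x, y, c, hc, hx, hy, hxy, hA1, hA2⟩ :=
    skew_normal_form s (EuclideanSpace ℝ (Fin 2 × Fin s)) (Matrix.toLpLin 2 2 M)
      (by simp) (by
        intro u v
        rw [key, key]
        simp only [Matrix.ofLp_toLpLin, Matrix.toLin'_apply]
        rw [← Matrix.vecMul_transpose, ← Matrix.dotProduct_mulVec, hM, Matrix.neg_mulVec,
          dotProduct_neg]) (by
        intro u v huv
        have := congrArg WithLp.ofLp huv
        simp only [Matrix.ofLp_toLpLin, Matrix.toLin'_apply] at this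
        exact WithLp.ofLp_injective 2 (Matrix.mulVec_injective_of_isUnit hu this))
  have hyx : ∀ i j, inner ℝ (y i) (x j) = (0 : ℝ) := fun i j => by
    rw [real_inner_comm, hxy]
  have hA1' : ∀ j, M *ᵥ (x j).ofLp = c j • (y j).ofLp := fun j => by
    simpa using congrArg WithLp.ofLp (hA1 j)
  have hA2' : ∀ j, M *ᵥ (y j).ofLp = -(c j • (x j).ofLp) := fun j => by
    simpa using congrArg WithLp.ofLp (hA2 j)
  simp only [key] at hx hy hxy hyx
  let q : Fin 2 × Fin s → (Fin 2 × Fin s → ℝ) := fun p => ![(x p.2).ofLp, (y p.2).ofLp] p.1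
  let Q : Matrix (Fin 2 × Fin s) (Fin 2 × Fin s) ℝ := Matrix.of fun i p => q p i
  have e1 : ∀ p r, (Qᵀ * Q) p r = q p ⬝ᵥ q r := fun p r => rfl
  have e2 : ∀ p r, (Qᵀ * M * Q) p r = q p ⬝ᵥ M *ᵥ q r := fun p r => by
    rw [Matrix.mul_assoc]; rfl
  refine ⟨Q, c, hc, ?_, ?_⟩
  · ext ⟨i, j⟩ ⟨k, l⟩
    rw [e1]
    fin_cases i <;> fin_cases k <;> simp [q, hx, hy, hxy, hyx, Matrix.one_apply]
  · ext ⟨i, j⟩ ⟨k, l⟩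
    rw [e2, Matrix.blockDiagonal_apply]
    fin_cases i <;> fin_cases k <;>
      simp [q, hx, hy, hxy, hyx, hA1', hA2'] <;> split_ifs <;> simp_all

open scoped MatrixOrder Matrix.Norms.L2Operator in
theorem pd_factor {n : Type} [Fintype n] [DecidableEq n] (α : Matrix n n ℝ) (hα : α.PosDef) :
    ∃ B : Matrix n n ℝ, IsUnit B ∧ α = Bᵀ * B := by
  obtain ⟨B, hB⟩ := CStarAlgebra.nonneg_iff_eq_star_mul_self.mp hα.posSemidef.nonneg
  rw [Matrix.star_eq_conjTranspose, Matrix.conjTranspose_eq_transpose_of_trivial] at hB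
  refine ⟨B, ?_, hB⟩
  have h := hα.isUnit
  rw [hB, Matrix.isUnit_iff_isUnit_det, Matrix.det_mul, IsUnit.mul_iff] at h
  exact (Matrix.isUnit_iff_isUnit_det _).2 h.2

theorem williamson_normal_form (s : ℕ) (hs : 1 ≤ s)
    (α : Matrix (Fin 2 × Fin s) (Fin 2 × Fin s) ℝ)
    (hα : α.PosDef) (hαsymm : α.IsSymm) :
    ∃ T : Matrix (Fin 2 × Fin s) (Fin 2 × Fin s) ℝ,
      Tᵀ * stdSymplectic s * T = stdSymplectic s ∧
      ∃ d : Fin s → ℝ, (∀ j, 0 < d j) ∧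
        Tᵀ * α * T =
          Matrix.blockDiagonal (fun j : Fin s => d j • (1 : Matrix (Fin 2) (Fin 2) ℝ)) := by
  obtain ⟨B, hB, hαB⟩ : ∃ B : Matrix (Fin 2 × Fin s) (Fin 2 × Fin s) ℝ,
      IsUnit B ∧ α = Bᵀ * B :=
    pd_factor α hα
  have hΔt : (stdSymplectic s)ᵀ = -stdSymplectic s := by
    unfold stdSymplectic
    rw [Matrix.blockDiagonal_transpose, ← Matrix.blockDiagonal_neg]
    congr 1
    funext j
    ext i k
    fin_cases i <;> fin_cases k <;> simp
  have hΔ2 : stdSymplectic s * -stdSymplectic s = 1 := by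
    unfold stdSymplectic
    rw [← Matrix.blockDiagonal_neg, ← Matrix.blockDiagonal_mul, ← Matrix.blockDiagonal_one]
    congr 1
    funext j
    ext i k
    fin_cases i <;> fin_cases k <;> simp
  have hΔu : IsUnit (stdSymplectic s) := IsUnit.of_mul_eq_one _ hΔ2
  obtain ⟨C, hBC⟩ : ∃ C, B * C = 1 := hB.exists_right_inv
  have hCu : IsUnit C := IsUnit.of_mul_eq_one _ (mul_eq_one_comm.mp hBC)
  have hCB : Cᵀ * Bᵀ = 1 := by rw [← Matrix.transpose_mul, hBC, Matrix.transpose_one]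
  obtain ⟨Q, c, hc, hQ, hQM⟩ := skew_matrix_normal_form s (Cᵀ * stdSymplectic s * C)
    (by simp [Matrix.transpose_mul, hΔt, Matrix.mul_assoc])
    ((((Matrix.isUnit_transpose C).2 hCu).mul hΔu).mul hCu)
  let D : Matrix (Fin 2 × Fin s) (Fin 2 × Fin s) ℝ :=
    Matrix.blockDiagonal fun j => (Real.sqrt (c j))⁻¹ • (1 : Matrix (Fin 2) (Fin 2) ℝ)
  have hD : Dᵀ = D := by
    simp only [D]
    rw [Matrix.blockDiagonal_transpose]
    simp
  refine ⟨C * Q * D, ?_, fun j => (c j)⁻¹, fun j => inv_pos.mpr (hc j), ?_⟩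
  · have : (C * Q * D)ᵀ * stdSymplectic s * (C * Q * D)
        = D * (Qᵀ * (Cᵀ * stdSymplectic s * C) * Q) * D := by
      simp only [Matrix.transpose_mul, hD, Matrix.mul_assoc]
    rw [this, hQM]
    simp only [D, stdSymplectic]
    rw [← Matrix.blockDiagonal_mul, ← Matrix.blockDiagonal_mul]
    congr 1
    funext j
    have h1 : (Real.sqrt (c j))⁻¹ * (c j * (Real.sqrt (c j))⁻¹) = 1 := by
      have h2 := Real.mul_self_sqrt (hc j).le
      have h3 := (Real.sqrt_pos.mpr (hc j)).ne'
      field_simp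
      nlinarith
    simp only [Matrix.smul_mul, Matrix.mul_smul, Matrix.one_mul, Matrix.mul_one, smul_smul]
    convert one_smul ℝ _ using 2
  · have : (C * Q * D)ᵀ * α * (C * Q * D) = D * (Qᵀ * ((Cᵀ * Bᵀ) * (B * C)) * Q) * D := by
      simp only [Matrix.transpose_mul, hD, hαB, Matrix.mul_assoc]
    rw [this, hCB, hBC, Matrix.mul_one, Matrix.mul_one, hQ, Matrix.mul_one]
    simp only [D]
    rw [← Matrix.blockDiagonal_mul]
    congr 1
    funext j
    simp only [Matrix.smul_mul, Matrix.mul_smul, Matrix.one_mul, smul_smul]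
    rw [← mul_inv, Real.mul_self_sqrt (hc j).le]
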